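/- arXiv:2604.22141 — 2 statements merged into one kernel-verified Lean document; each statement's English description precedes it below -/
import Mathlib

section
/- Let 0 ≤ k ≤ n and m ≥ k be integers and let λ = (λ_1 ≥ λ_2 ≥ … ≥ λ_k ≥ 0) be a partition with λ_1 ≤ m − k. Then in F = ℚ(z_1,…,z_n) one has s_{((m−k)^{n−k}, λ_1, λ_2, …, λ_k)}(z_1,…,z_n) = Σ over all k-element subsets S ⊆ {1,…,n} of s_λ(z_S) · [∏_{j∉S} z_j^m] / [∏_{i∈S} ∏_{j∉S} (z_j − z_i)]. -/
open scoped BigOperators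

noncomputable section

/-- `F N` is the field `ℚ(z_1, …, z_N)` of rational functions in `N` variables. -/
abbrev F (N : ℕ) := FractionRing (MvPolynomial (Fin N) ℚ)

/-- The variable `z_a` viewed inside `F N`. -/
noncomputable def z {N : ℕ} (a : Fin N) : F N :=
  algebraMap (MvPolynomial (Fin N) ℚ) (F N) (MvPolynomial.X a)

/-- `z_A^p := ∏_{a ∈ A} z_a^p`. -/
noncomputable def zpowProd {N : ℕ} (A : Finset (Fin N)) (p : ℤ) : F N :=
  ∏ a ∈ A, z a ^ p

/-- `1 − z_A/z_B := ∏_{a∈A} ∏_{b∈B} (1 − z_a/z_b)`. -/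
noncomputable def oneSub {N : ℕ} (A B : Finset (Fin N)) : F N :=
  ∏ a ∈ A, ∏ b ∈ B, (1 - z a / z b)

/-- `z_A − z_B := ∏_{a∈A} ∏_{b∈B} (z_a − z_b)`. -/
noncomputable def zsub {N : ℕ} (A B : Finset (Fin N)) : F N :=
  ∏ a ∈ A, ∏ b ∈ B, (z a - z b)

/-- Read an exponent sequence off a list, padding with `0`. -/
def padded (L : List ℤ) : ℕ → ℤ := fun t => L.getD t 0

/-- The Schur polynomial (bialternant form) associated with the index set
`A ⊆ {1,…,N}` (with its increasing enumeration) and the exponent sequence `lam`. -/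
noncomputable def schur {N : ℕ} (A : Finset (Fin N)) (lam : ℕ → ℤ) : F N :=
  Matrix.det (Matrix.of fun i j : Fin A.card =>
      z ((A.orderIsoOfFin rfl i : Fin N)) ^ (lam j + (A.card : ℤ) - 1 - (j : ℤ)))
    / Matrix.det (Matrix.of fun i j : Fin A.card =>
      z ((A.orderIsoOfFin rfl i : Fin N)) ^ ((A.card : ℤ) - 1 - (j : ℤ)))


theorem F.z_injective {N : ℕ} : Function.Injective (z : Fin N → F N) := fun _ _ h =>
  MvPolynomial.X_injective (IsFractionRing.injective (MvPolynomial (Fin N) ℚ) (F N) h)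

theorem F.z_ne_zero {N : ℕ} (a : Fin N) : (z a : F N) ≠ 0 := fun h =>
  MvPolynomial.X_ne_zero a
    ((map_eq_zero_iff _ (IsFractionRing.injective (MvPolynomial (Fin N) ℚ) (F N))).1 h)

/-- The enumeration of `α` which lists the complement of `S` first and then `S`, both in
increasing order. -/
def complSumEquiv {α : Type*} [Fintype α] [LinearOrder α] {l k : ℕ}
    (hα : Fintype.card α = l + k) (S : Finset α) (hS : S.card = k) : Fin l ⊕ Fin k ≃ α :=
  (Equiv.sumComm _ _).trans
    (finSumEquivOfFinset hS (by rw [Finset.card_compl, hα, hS, Nat.add_sub_cancel]))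

theorem complSumEquiv_inl {α : Type*} [Fintype α] [LinearOrder α] {l k : ℕ}
    (hα : Fintype.card α = l + k) (S : Finset α) (hS : S.card = k) (hS' : Sᶜ.card = l)
    (i : Fin l) :
    complSumEquiv hα S hS (Sum.inl i) = Sᶜ.orderEmbOfFin hS' i := by
  simp [complSumEquiv]

theorem complSumEquiv_inr {α : Type*} [Fintype α] [LinearOrder α] {l k : ℕ}
    (hα : Fintype.card α = l + k) (S : Finset α) (hS : S.card = k) (i : Fin k) :
    complSumEquiv hα S hS (Sum.inr i) = S.orderEmbOfFin hS i := by
  simp [complSumEquiv]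

theorem image_complSumEquiv_inr {α : Type*} [Fintype α] [LinearOrder α] {l k : ℕ}
    (hα : Fintype.card α = l + k) (S : Finset α) (hS : S.card = k) :
    Finset.univ.image (fun i => complSumEquiv hα S hS (Sum.inr i)) = S := by
  simp only [complSumEquiv_inr]
  exact S.image_orderEmbOfFin_univ hS

/-- Every enumeration of `α` by `Fin l ⊕ Fin k` is obtained from exactly one `k`-element subset
`S` by rearranging the complement of `S` and `S`. -/
theorem bijective_sumCongr_trans_complSumEquiv {α : Type*} [Fintype α] [LinearOrder α] {l k : ℕ}
    (hα : Fintype.card α = l + k) :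
    Function.Bijective
      (fun x : {S : Finset α // S.card = k} × Equiv.Perm (Fin l) × Equiv.Perm (Fin k) =>
        (Equiv.sumCongr x.2.1 x.2.2).trans (complSumEquiv hα x.1.1 x.1.2)) := by
  constructor
  · rintro ⟨⟨S, hS⟩, p, q⟩ ⟨⟨T, hT⟩, p', q'⟩ h
    simp only at h
    have key : ∀ (S : Finset α) (hS : S.card = k) (p : Equiv.Perm (Fin l))
        (q : Equiv.Perm (Fin k)), Finset.univ.image (fun i =>
          ((Equiv.sumCongr p q).trans (complSumEquiv hα S hS)) (Sum.inr i)) = S := by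
      intro S hS p q
      conv_rhs => rw [← image_complSumEquiv_inr hα S hS]
      ext a
      simp only [Finset.mem_image, Finset.mem_univ, true_and, Equiv.trans_apply,
        Equiv.sumCongr_apply, Sum.map_inr]
      exact (q.surjective.exists (p := fun j => complSumEquiv hα S hS (Sum.inr j) = a)).symm
    obtain rfl : S = T := by rw [← key S hS p q, h, key]
    have h' : Equiv.sumCongr p q = Equiv.sumCongr p' q' := by
      ext1 x
      exact (complSumEquiv hα S hS).injective (DFunLike.congr_fun h x)
    have := @Equiv.Perm.sumCongrHom_injective (Fin l) (Fin k) (p, q) (p', q') h'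
    simp_all
  · intro σ
    have hS : (Finset.univ.image (fun i => σ (Sum.inr i))).card = k := by
      simp [Finset.card_image_of_injective _ (f := fun i => σ (Sum.inr i))
        (σ.injective.comp Sum.inr_injective)]
    set S := Finset.univ.image (fun i => σ (Sum.inr i)) with hSdef
    have hmem : Set.MapsTo (σ.trans (complSumEquiv hα S hS).symm) (Set.range Sum.inl)
        (Set.range Sum.inl) := by
      rintro _ ⟨i, rfl⟩
      rcases h : (σ.trans (complSumEquiv hα S hS).symm) (Sum.inl i) with j | j
      · exact ⟨j, rfl⟩
      · have hj : complSumEquiv hα S hS (Sum.inr j) ∈ S := by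
          rw [complSumEquiv_inr]
          exact S.orderEmbOfFin_mem hS j
        rw [← h, Equiv.trans_apply, Equiv.apply_symm_apply, hSdef] at hj
        simp at hj
    obtain ⟨⟨p, q⟩, hpq⟩ := Equiv.Perm.mem_sumCongrHom_range_of_perm_mapsTo_inl hmem
    refine ⟨⟨⟨S, hS⟩, p, q⟩, ?_⟩
    have hpq' : Equiv.sumCongr p q = σ.trans (complSumEquiv hα S hS).symm := hpq
    simp only [hpq']
    ext x
    simp

/-- Laplace expansion of a determinant along a block of `l` columns. -/
theorem Matrix.det_laplace {α R : Type*} [Fintype α] [LinearOrder α] [CommRing R] {l k : ℕ}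
    (hα : Fintype.card α = l + k) (c : Fin l ⊕ Fin k ≃ α) (M : Matrix α α R) :
    M.det = ∑ S : {S : Finset α // S.card = k},
      ((Equiv.Perm.sign (c.symm.trans (complSumEquiv hα S.1 S.2)) : ℤ) : R) *
        ((M.submatrix (fun i => complSumEquiv hα S.1 S.2 (Sum.inl i))
            (fun j => c (Sum.inl j))).det *
          (M.submatrix (fun i => complSumEquiv hα S.1 S.2 (Sum.inr i))
            (fun j => c (Sum.inr j))).det) := by
  rw [Matrix.det_apply', ← (Equiv.equivCongr c (Equiv.refl α)).sum_comp,
    ← (bijective_sumCongr_trans_complSumEquiv hα).sum_comp, Fintype.sum_prod_type]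
  refine Finset.sum_congr rfl fun S _ => ?_
  rw [Matrix.det_apply', Matrix.det_apply', Finset.sum_mul_sum, Finset.mul_sum,
    Fintype.sum_prod_type]
  refine Finset.sum_congr rfl fun p _ => ?_
  rw [Finset.mul_sum]
  refine Finset.sum_congr rfl fun q _ => ?_
  rw [← c.prod_comp, Fintype.prod_sum_type]
  have hs : Equiv.Perm.sign ((Equiv.equivCongr c (Equiv.refl α))
      ((Equiv.sumCongr p q).trans (complSumEquiv hα S.1 S.2))) =
      Equiv.Perm.sign (c.symm.trans (complSumEquiv hα S.1 S.2)) *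
        (Equiv.Perm.sign p * Equiv.Perm.sign q) := by
    rw [← Equiv.Perm.sign_sumCongr, ← Equiv.Perm.sign_permCongr c (Equiv.Perm.sumCongr p q),
      ← Equiv.Perm.sign_mul]
    congr 1
    ext x
    simp [Equiv.permCongr]
  rw [hs]
  simp
  ring

/-- The Vandermonde determinant with decreasing exponents. -/
theorem Matrix.det_of_pow_rev {R : Type*} [CommRing R] {N : ℕ} (v : Fin N → R) :
    (Matrix.of fun i j : Fin N => v i ^ (j.rev : ℕ)).det =
      ∏ i, ∏ j, if i < j then v i - v j else 1 := by
  have h : (Matrix.of fun i j : Fin N => v i ^ (j.rev : ℕ)) = Matrix.projVandermonde 1 v := by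
    ext i j
    simp [Matrix.projVandermonde_apply]
  rw [h, Matrix.det_projVandermonde]
  refine Finset.prod_congr rfl fun i _ => ?_
  rw [← Finset.prod_filter]
  refine Finset.prod_congr ?_ fun j _ => by simp
  ext j
  simp

theorem Matrix.det_of_pow_rev_ne_zero {R : Type*} [CommRing R] [IsDomain R] {N : ℕ}
    {v : Fin N → R} (hv : Function.Injective v) :
    (Matrix.of fun i j : Fin N => v i ^ (j.rev : ℕ)).det ≠ 0 := by
  rw [Matrix.det_of_pow_rev, Finset.prod_ne_zero_iff]
  intro i _
  rw [Finset.prod_ne_zero_iff]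
  intro j _
  split_ifs with h
  · exact sub_ne_zero.2 (hv.ne h.ne)
  · exact one_ne_zero

theorem Matrix.det_of_pow_rev_add {R : Type*} [CommRing R] {l k : ℕ} (v : Fin (l + k) → R) :
    (Matrix.of fun i j : Fin (l + k) => v i ^ (j.rev : ℕ)).det =
      (Matrix.of fun i j : Fin l => v (Fin.castAdd k i) ^ (j.rev : ℕ)).det *
        (Matrix.of fun i j : Fin k => v (Fin.natAdd l i) ^ (j.rev : ℕ)).det *
        ∏ i : Fin l, ∏ j : Fin k, (v (Fin.castAdd k i) - v (Fin.natAdd l j)) := by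
  simp only [Matrix.det_of_pow_rev, Fin.prod_univ_add, Finset.prod_mul_distrib]
  have h1 : ∀ (i : Fin l) (j : Fin k), Fin.castAdd k i < Fin.natAdd l j := fun i j => by
    simp only [Fin.lt_def, Fin.val_castAdd, Fin.val_natAdd]; omega
  have h2 : ∀ (i : Fin l) (j : Fin k), ¬ Fin.natAdd l j < Fin.castAdd k i := fun i j =>
    (h1 i j).asymm
  have h3 : ∀ i j : Fin l, Fin.castAdd k i < Fin.castAdd k j ↔ i < j := fun i j =>
    Iff.rfl
  have h4 : ∀ i j : Fin k, Fin.natAdd l i < Fin.natAdd l j ↔ i < j := fun i j =>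
    Fin.natAdd_lt_natAdd_iff l
  simp only [h1, h2, h3, h4, if_true, if_false, Finset.prod_const_one]
  ring

theorem schur_eq_of_card {N K : ℕ} (A : Finset (Fin N)) (hA : A.card = K) (lam : ℕ → ℤ) :
    schur A lam =
      (Matrix.of fun i j : Fin K =>
        z (A.orderEmbOfFin hA i) ^ (lam j + (K : ℤ) - 1 - (j : ℤ))).det /
      (Matrix.of fun i j : Fin K => z (A.orderEmbOfFin hA i) ^ (j.rev : ℕ)).det := by
  subst hA
  rw [schur]
  congr 2
  ext i j
  simp only [Matrix.of_apply, ← zpow_natCast, Fin.val_rev]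
  congr 2
  omega

theorem schur_univ {N : ℕ} (lam : ℕ → ℤ) :
    schur (Finset.univ : Finset (Fin N)) lam =
      (Matrix.of fun i j : Fin N => z i ^ (lam j + (N : ℤ) - 1 - (j : ℤ))).det /
      (Matrix.of fun i j : Fin N => z i ^ (j.rev : ℕ)).det := by
  rw [schur_eq_of_card Finset.univ (Finset.card_fin N)]
  have h : Finset.univ.orderEmbOfFin (Finset.card_fin N) = RelEmbedding.refl (· ≤ ·) :=
    (Finset.orderEmbOfFin_unique' _ (fun _ => Finset.mem_univ _)).symm
  simp [h]

theorem prod_orderEmbOfFin {N K : ℕ} {M : Type*} [CommMonoid M] (A : Finset (Fin N))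
    (hA : A.card = K) (f : Fin N → M) : ∏ i, f (A.orderEmbOfFin hA i) = ∏ a ∈ A, f a := by
  conv_rhs => rw [← Finset.map_orderEmbOfFin_univ A hA, Finset.prod_map]
  rfl

open Classical in
/-- the Fehér–Némethi–Rimányi identity for Schur polynomials. -/
theorem statement4 (n k m : ℕ) (hk : k ≤ n) (hm : k ≤ m)
    (lam : Fin k → ℕ) (hanti : ∀ j j' : Fin k, j ≤ j' → lam j' ≤ lam j)
    (hbound : ∀ j, lam j + k ≤ m) :
    schur (Finset.univ : Finset (Fin n))
        (padded (List.replicate (n - k) ((m : ℤ) - k) ++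
          List.ofFn fun j : Fin k => (lam j : ℤ)))
      = ∑ S ∈ Finset.powersetCard k (Finset.univ : Finset (Fin n)),
          schur S (padded (List.ofFn fun j : Fin k => (lam j : ℤ))) *
            (∏ j ∈ Sᶜ, z j ^ (m : ℤ)) / zsub Sᶜ S := by
  obtain ⟨l, rfl⟩ : ∃ l, n = l + k := ⟨n - k, by omega⟩
  rw [schur_univ, Nat.add_sub_cancel]
  have hα : Fintype.card (Fin (l + k)) = l + k := Fintype.card_fin _
  rw [Matrix.det_laplace hα finSumFinEquiv, Finset.sum_div,
    Finset.sum_subtype (p := fun S : Finset (Fin (l + k)) => S.card = k) _ (by simp)]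
  refine Finset.sum_congr rfl ?_
  rintro ⟨S, hS⟩ -
  have hS' : Sᶜ.card = l := by rw [Finset.card_compl, hα, hS, Nat.add_sub_cancel]
  set e := complSumEquiv hα S hS with he
  set ε : F (l + k) :=
    ((Equiv.Perm.sign (finSumFinEquiv.symm.trans e) : ℤ) : F (l + k)) with hε
  have hε2 : ε * ε = 1 := by
    rw [hε, ← Int.cast_mul, ← Units.val_mul, Int.units_mul_self]
    simp
  have hV : (Matrix.of fun i j : Fin (l + k) => (z i : F (l + k)) ^ (j.rev : ℕ)).det =
      ε * ((Matrix.of fun i j : Fin l =>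
          (z (Sᶜ.orderEmbOfFin hS' i) : F (l + k)) ^ (j.rev : ℕ)).det *
        (Matrix.of fun i j : Fin k =>
          (z (S.orderEmbOfFin hS i) : F (l + k)) ^ (j.rev : ℕ)).det * zsub Sᶜ S) := by
    have h := Matrix.det_permute (finSumFinEquiv.symm.trans e)
      (Matrix.of fun i j : Fin (l + k) => (z i : F (l + k)) ^ (j.rev : ℕ))
    have h2 := Matrix.det_of_pow_rev_add
      (fun i => (z ((finSumFinEquiv.symm.trans e) i) : F (l + k)))
    have h3 : ∏ i : Fin l, ∏ j : Fin k, ((z (Sᶜ.orderEmbOfFin hS' i) : F (l + k)) -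
        z (S.orderEmbOfFin hS j)) = zsub Sᶜ S := by
      rw [zsub, ← prod_orderEmbOfFin Sᶜ hS']
      exact Finset.prod_congr rfl fun i _ =>
        prod_orderEmbOfFin S hS fun b => (z (Sᶜ.orderEmbOfFin hS' i) : F (l + k)) - z b
    simp only [Equiv.trans_apply, finSumFinEquiv_symm_apply_castAdd,
      finSumFinEquiv_symm_apply_natAdd, he, complSumEquiv_inl hα S hS hS',
      complSumEquiv_inr, h3] at h2
    rw [← h2]
    have h4 : ((Matrix.of fun i j : Fin (l + k) => (z i : F (l + k)) ^ (j.rev : ℕ)).submatrix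
        (finSumFinEquiv.symm.trans e) id).det = ε *
        (Matrix.of fun i j : Fin (l + k) => (z i : F (l + k)) ^ (j.rev : ℕ)).det := h
    calc _ = ε * (ε * (Matrix.of fun i j : Fin (l + k) =>
            (z i : F (l + k)) ^ (j.rev : ℕ)).det) := by rw [← mul_assoc, hε2, one_mul]
      _ = _ := by rw [← h4]; rfl
  have hN1 : ((Matrix.of fun i j : Fin (l + k) => (z i : F (l + k)) ^
      (padded (List.replicate l ((m : ℤ) - k) ++ List.ofFn fun j : Fin k => (lam j : ℤ)) j +
        ((l + k : ℕ) : ℤ) - 1 - (j : ℤ))).submatrix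
        (fun i => e (Sum.inl i)) (fun j => finSumFinEquiv (Sum.inl j))).det =
      (∏ j ∈ Sᶜ, z j ^ (m : ℤ)) * (Matrix.of fun i j : Fin l =>
          (z (Sᶜ.orderEmbOfFin hS' i) : F (l + k)) ^ (j.rev : ℕ)).det := by
    rw [← prod_orderEmbOfFin Sᶜ hS', ← Matrix.det_mul_column]
    congr 1
    ext i j
    simp only [Matrix.submatrix_apply, Matrix.of_apply, he, complSumEquiv_inl hα S hS hS',
      finSumFinEquiv_apply_left, ← zpow_natCast, Fin.val_castAdd]
    rw [← zpow_add₀ (F.z_ne_zero _)]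
    congr 1
    have : padded (List.replicate l ((m : ℤ) - k) ++
        List.ofFn fun j : Fin k => (lam j : ℤ)) j = (m : ℤ) - k := by
      simp [padded, List.getD_eq_getElem?_getD, List.getElem?_append]
    rw [this, Fin.val_rev]
    omega
  have hN2 : ((Matrix.of fun i j : Fin (l + k) => (z i : F (l + k)) ^
      (padded (List.replicate l ((m : ℤ) - k) ++ List.ofFn fun j : Fin k => (lam j : ℤ)) j +
        ((l + k : ℕ) : ℤ) - 1 - (j : ℤ))).submatrix
        (fun i => e (Sum.inr i)) (fun j => finSumFinEquiv (Sum.inr j))) =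
      Matrix.of fun i j : Fin k => (z (S.orderEmbOfFin hS i) : F (l + k)) ^
        (padded (List.ofFn fun j : Fin k => (lam j : ℤ)) j + (k : ℤ) - 1 - (j : ℤ)) := by
    ext i j
    simp only [Matrix.submatrix_apply, Matrix.of_apply, he, complSumEquiv_inr,
      finSumFinEquiv_apply_right, Fin.val_natAdd]
    congr 1
    have : padded (List.replicate l ((m : ℤ) - k) ++
        List.ofFn fun j : Fin k => (lam j : ℤ)) (l + j) =
        padded (List.ofFn fun j : Fin k => (lam j : ℤ)) j := by
      simp [padded, List.getD_eq_getElem?_getD]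
    rw [this]
    push_cast
    ring
  rw [hN1, hN2, hV, schur_eq_of_card S hS]
  have hε0 : ε ≠ 0 := left_ne_zero_of_mul_eq_one hε2
  have hV1 := Matrix.det_of_pow_rev_ne_zero
    ((F.z_injective (N := l + k)).comp (Sᶜ.orderEmbOfFin hS').injective)
  have hV2 := Matrix.det_of_pow_rev_ne_zero
    ((F.z_injective (N := l + k)).comp (S.orderEmbOfFin hS).injective)
  simp only [Function.comp_apply] at hV1 hV2
  generalize (Matrix.of fun i j : Fin l =>
    (z (Sᶜ.orderEmbOfFin hS' i) : F (l + k)) ^ (j.rev : ℕ)).det = V1 at *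
  generalize (Matrix.of fun i j : Fin k =>
    (z (S.orderEmbOfFin hS i) : F (l + k)) ^ (j.rev : ℕ)).det = V2 at *
  generalize (Matrix.of fun i j : Fin k => (z (S.orderEmbOfFin hS i) : F (l + k)) ^
        (padded (List.ofFn fun j : Fin k => (lam j : ℤ)) j + (k : ℤ) - 1 - (j : ℤ))).det = D
  rw [mul_div_mul_left _ _ hε0, mul_assoc V1, mul_comm _ V1, mul_assoc V1,
    mul_div_mul_left _ _ hV1, div_mul_eq_mul_div, div_div, mul_comm D]

end
end

section
/- Let z_1,…,z_a ∈ K be nonzero and w_1,…,w_b ∈ K. Then the coefficient of the vacuum basis vector |0,0,0⟩ in X₃(z_1) ∘ ⋯ ∘ X₃(z_a) ∘ X₁(w_1) ∘ ⋯ ∘ X₁(w_b) applied to |0,0,0⟩ equals (z_1⋯z_a)^{-1} · Σ_{ℓ=0}^{min(a,b)} [∏_{k=1}^{ℓ} (1 − q^{2k})] · e_{a−ℓ}(z_1,…,z_a) · e_ℓ(w_1,…,w_b), where e_i denotes the i-th elementary symmetric polynomial. -/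
noncomputable section

variable (K : Type*) [Field K]

/-- The vector space with basis `|a,b,c⟩`, `a,b,c ∈ ℕ`. -/
abbrev V := (ℕ × ℕ × ℕ) →₀ K

/-- The basis vector `|a,b,c⟩`. -/
noncomputable def bs (p : ℕ × ℕ × ℕ) : V K := Finsupp.single p 1

/-- The linear operator determined by its values on the basis vectors. -/
noncomputable def opOf (g : ℕ × ℕ × ℕ → V K) : V K →ₗ[K] V K :=
  Finsupp.linearCombination K g

variable {K} (q : K)

noncomputable def ap11 : V K →ₗ[K] V K := opOf K fun p => bs K (p.1 + 1, p.2.1, p.2.2)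
noncomputable def am11 : V K →ₗ[K] V K :=
  opOf K fun p => (1 - q ^ (2 * p.1)) • bs K (p.1 - 1, p.2.1, p.2.2)
noncomputable def k11 : V K →ₗ[K] V K := opOf K fun p => q ^ p.1 • bs K p
noncomputable def ap12 : V K →ₗ[K] V K := opOf K fun p => bs K (p.1, p.2.1 + 1, p.2.2)
noncomputable def am12 : V K →ₗ[K] V K :=
  opOf K fun p => (1 - q ^ (2 * p.2.1)) • bs K (p.1, p.2.1 - 1, p.2.2)
noncomputable def k12 : V K →ₗ[K] V K := opOf K fun p => q ^ p.2.1 • bs K p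
noncomputable def ap21 : V K →ₗ[K] V K := opOf K fun p => bs K (p.1, p.2.1, p.2.2 + 1)
noncomputable def am21 : V K →ₗ[K] V K :=
  opOf K fun p => (1 - q ^ (2 * p.2.2)) • bs K (p.1, p.2.1, p.2.2 - 1)
noncomputable def k21 : V K →ₗ[K] V K := opOf K fun p => q ^ p.2.2 • bs K p

/-- `X₁(z) = a⁺₁₂a⁻₁₁k₂₁ + z·a⁺₁₂k₂₁ + k₁₁k₂₁`. -/
noncomputable def X1 (z : K) : V K →ₗ[K] V K :=
  ap12 ∘ₗ am11 q ∘ₗ k21 q + z • (ap12 ∘ₗ k21 q) + k11 q ∘ₗ k21 q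


/-- `X₃(z) = 1 + z⁻¹·a⁺₁₁a⁻₁₂a⁻₂₁ + z⁻¹·a⁻₁₁ + z⁻²·a⁻₁₂a⁻₂₁ + z⁻¹·a⁻₁₂k₁₁ − qz⁻¹·a⁻₂₁k₁₁`. -/
noncomputable def X3 (z : K) : V K →ₗ[K] V K :=
  LinearMap.id + z⁻¹ • (ap11 ∘ₗ am12 q ∘ₗ am21 q) + z⁻¹ • am11 q
    + (z⁻¹) ^ 2 • (am12 q ∘ₗ am21 q) + z⁻¹ • (am12 q ∘ₗ k11 q)
    - (q * z⁻¹) • (am21 q ∘ₗ k11 q)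

/-- The `i`-th elementary symmetric polynomial evaluated at `x_1,…,x_n`. -/
noncomputable def esymm {n : ℕ} (i : ℕ) (x : Fin n → K) : K :=
  ∑ S ∈ Finset.powersetCard i (Finset.univ : Finset (Fin n)), ∏ j ∈ S, x j

open Polynomial in
lemma coeff_prod_one_add_C_mul_X {n : ℕ} (x : Fin n → K) (l : ℕ) :
    (∏ t, (1 + C (x t) * X)).coeff l = esymm l x := by
  rw [Finset.prod_one_add, Polynomial.finsetSum_coeff, esymm, Finset.powersetCard_eq_filter,
    Finset.sum_filter]
  refine Finset.sum_congr rfl fun S _ => ?_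
  rw [Finset.prod_mul_distrib, Finset.prod_const, ← map_prod, coeff_C_mul_X_pow]
  simp only [eq_comm]

lemma esymm_eq_zero_of_lt {n l : ℕ} (h : n < l) (x : Fin n → K) : esymm l x = 0 := by
  rw [esymm, Finset.powersetCard_eq_empty.2 (by simpa using h), Finset.sum_empty]

lemma esymm_inv {n l : ℕ} (h : l ≤ n) (x : Fin n → K) (hx : ∀ t, x t ≠ 0) :
    esymm l (fun t => (x t)⁻¹) = (∏ t, x t)⁻¹ * esymm (n - l) x := by
  rw [esymm, esymm, Finset.mul_sum]
  refine Finset.sum_nbij' (fun S => Sᶜ) (fun S => Sᶜ) ?_ ?_ ?_ ?_ ?_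
  · intro S hS
    simp only [Finset.mem_powersetCard, Finset.subset_univ, true_and] at hS ⊢
    rw [Finset.card_compl, hS, Fintype.card_fin]
  · intro S hS
    simp only [Finset.mem_powersetCard, Finset.subset_univ, true_and] at hS ⊢
    rw [Finset.card_compl, hS, Fintype.card_fin]
    omega
  · simp
  · simp
  · intro S _
    have h1 : ∏ t ∈ S, x t ≠ 0 := Finset.prod_ne_zero_iff.2 fun t _ => hx t
    have h2 : ∏ t ∈ Sᶜ, x t ≠ 0 := Finset.prod_ne_zero_iff.2 fun t _ => hx t
    rw [← Finset.prod_mul_prod_compl S x, Finset.prod_inv_distrib]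
    field_simp

lemma opOf_bs (g : ℕ × ℕ × ℕ → V K) (p : ℕ × ℕ × ℕ) : opOf K g (bs K p) = g p := by
  simp [opOf, bs]

lemma X1_bs (w : K) (l : ℕ) :
    X1 q w (bs K (0, l, 0)) = bs K (0, l, 0) + w • bs K (0, l + 1, 0) := by
  simp only [X1, ap12, am11, k21, k11, LinearMap.add_apply, LinearMap.comp_apply,
    LinearMap.smul_apply, opOf_bs, map_smul]
  simp [add_comm]

lemma am12_bs (l : ℕ) :
    am12 q (bs K (0, l, 0)) = (1 - q ^ (2 * l)) • bs K (0, l - 1, 0) := by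
  simp only [am12, opOf_bs]

lemma X3_bs (z : K) (l : ℕ) :
    X3 q z (bs K (0, l, 0)) = bs K (0, l, 0) + z⁻¹ • am12 q (bs K (0, l, 0)) := by
  simp only [X3, ap11, am11, am12, am21, k11, LinearMap.add_apply, LinearMap.sub_apply,
    LinearMap.comp_apply, LinearMap.smul_apply, LinearMap.id_apply, opOf_bs, map_smul]
  simp

/-- The span of the vectors `|0,l,0⟩`. -/
def middleSpan (K : Type*) [Field K] : Submodule K (V K) :=
  Submodule.span K (Set.range fun l : ℕ => bs K (0, l, 0))

lemma bs_mem_middleSpan (l : ℕ) : bs K (0, l, 0) ∈ middleSpan K :=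
  Submodule.subset_span ⟨l, rfl⟩

lemma map_mem_middleSpan {f : V K →ₗ[K] V K} (hf : ∀ l, f (bs K (0, l, 0)) ∈ middleSpan K)
    {v : V K} (hv : v ∈ middleSpan K) : f v ∈ middleSpan K := by
  have h : middleSpan K ≤ (middleSpan K).comap f := by
    rw [middleSpan, Submodule.span_le]
    rintro _ ⟨l, rfl⟩
    exact hf l
  exact h hv

lemma eqOn_middleSpan {f g : V K →ₗ[K] V K} (h : ∀ l, f (bs K (0, l, 0)) = g (bs K (0, l, 0)))
    {v : V K} (hv : v ∈ middleSpan K) : f v = g v :=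
  LinearMap.eqOn_span (by rintro _ ⟨l, rfl⟩; exact h l) hv

open Polynomial in
/-- A product of operators `F x` that act on `|0,l,0⟩` as `1 + x A` is a polynomial in `A`. -/
lemma prod_apply_eq_aeval {A : Module.End K (V K)} {F : K → Module.End K (V K)}
    (hA : ∀ l, A (bs K (0, l, 0)) ∈ middleSpan K)
    (hF : ∀ x l, F x (bs K (0, l, 0)) = bs K (0, l, 0) + x • A (bs K (0, l, 0)))
    (L : List K) {v : V K} (hv : v ∈ middleSpan K) :
    (L.map F).prod v = aeval A (L.map fun x => 1 + C x * X).prod v ∧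
      (L.map F).prod v ∈ middleSpan K := by
  induction L with
  | nil => simpa using hv
  | cons x L ih =>
    have hFA : ∀ u ∈ middleSpan K, F x u = aeval A (1 + C x * X) u := fun u hu =>
      eqOn_middleSpan (fun l => by simp [hF, Module.algebraMap_end_apply]) hu
    simp only [List.map_cons, List.prod_cons, Module.End.mul_apply, map_mul]
    refine ⟨by rw [← ih.1]; exact hFA _ ih.2, map_mem_middleSpan (fun l => ?_) ih.2⟩
    rw [hF]
    exact add_mem (bs_mem_middleSpan l) (Submodule.smul_mem _ _ (hA l))

open Polynomial in
lemma prod_ofFn_apply {A : Module.End K (V K)} {F : K → Module.End K (V K)}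
    (hA : ∀ l, A (bs K (0, l, 0)) ∈ middleSpan K)
    (hF : ∀ x l, F x (bs K (0, l, 0)) = bs K (0, l, 0) + x • A (bs K (0, l, 0)))
    {n : ℕ} (x : Fin n → K) {v : V K} (hv : v ∈ middleSpan K) :
    (List.ofFn fun t => F (x t)).prod v =
      ∑ l ∈ Finset.range (n + 1), esymm l x • (A ^ l) v := by
  have h := (prod_apply_eq_aeval hA hF (List.ofFn x) hv).1
  simp only [List.map_ofFn, Function.comp_def] at h
  have hdeg : (∏ t, (1 + C (x t) * X)).natDegree < n + 1 := by
    refine Nat.lt_succ_of_le ((natDegree_le_iff_coeff_eq_zero).2 fun l hl => ?_)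
    rw [coeff_prod_one_add_C_mul_X, esymm_eq_zero_of_lt hl]
  rw [h, List.prod_ofFn, aeval_eq_sum_range' hdeg, LinearMap.sum_apply]
  simp [coeff_prod_one_add_C_mul_X]

lemma ap12_pow_vacuum (l : ℕ) :
    ((ap12 : Module.End K (V K)) ^ l) (bs K (0, 0, 0)) = bs K (0, l, 0) := by
  induction l with
  | zero => simp
  | succ l ih => rw [pow_succ', Module.End.mul_apply, ih, ap12, opOf_bs]

lemma am12_pow_bs_vacuum (j l : ℕ) :
    ((am12 q : Module.End K (V K)) ^ j) (bs K (0, l, 0)) (0, 0, 0) =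
      if j = l then ∏ k ∈ Finset.range l, (1 - q ^ (2 * (k + 1))) else 0 := by
  induction j generalizing l with
  | zero => cases l <;> simp [bs]
  | succ j ih =>
    rw [pow_succ, Module.End.mul_apply, am12_bs, map_smul, Finsupp.smul_apply, ih]
    cases l with
    | zero => simp
    | succ l =>
      simp only [Nat.add_sub_cancel, Nat.add_right_cancel_iff, Finset.prod_range_succ]
      split_ifs <;> simp [mul_comm]

/-- the vacuum expectation value
`⟨0,0,0| X₃(z_1)⋯X₃(z_a) X₁(w_1)⋯X₁(w_b) |0,0,0⟩`. -/
theorem statement19 (a b : ℕ) (zs : Fin a → K) (hz : ∀ t, zs t ≠ 0) (ws : Fin b → K) :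
    (((List.ofFn fun t : Fin a => (X3 q (zs t) : Module.End K (V K))) ++
        (List.ofFn fun t : Fin b => (X1 q (ws t) : Module.End K (V K)))).prod
      (bs K (0, 0, 0))) (0, 0, 0)
      = (∏ t, zs t)⁻¹ *
        ∑ l ∈ Finset.range (min a b + 1),
          (∏ k ∈ Finset.range l, (1 - q ^ (2 * (k + 1)))) *
            esymm (a - l) zs * esymm l ws := by
  have hX1 : ∀ x l, X1 q x (bs K (0, l, 0)) =
      bs K (0, l, 0) + x • (ap12 : Module.End K (V K)) (bs K (0, l, 0)) := fun x l => by
    rw [X1_bs, ap12, opOf_bs]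
  have hX3 : ∀ x l, X3 q x⁻¹ (bs K (0, l, 0)) =
      bs K (0, l, 0) + x • am12 q (bs K (0, l, 0)) := fun x l => by
    rw [X3_bs, inv_inv]
  have hap : ∀ l, (ap12 : Module.End K (V K)) (bs K (0, l, 0)) ∈ middleSpan K := fun l => by
    rw [ap12, opOf_bs]
    exact bs_mem_middleSpan (l + 1)
  have ham : ∀ l, am12 q (bs K (0, l, 0)) ∈ middleSpan K := fun l => by
    rw [am12_bs]
    exact Submodule.smul_mem _ _ (bs_mem_middleSpan _)
  have h3 : ∀ l, (List.ofFn fun t => (X3 q (zs t) : Module.End K (V K))).prod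
      (bs K (0, l, 0)) (0, 0, 0) =
      esymm l (fun t => (zs t)⁻¹) * ∏ k ∈ Finset.range l, (1 - q ^ (2 * (k + 1))) := fun l => by
    have h := prod_ofFn_apply (F := fun x => X3 q x⁻¹) ham hX3 (fun t => (zs t)⁻¹)
      (bs_mem_middleSpan l)
    simp only [inv_inv] at h
    rw [h, Finsupp.finsetSum_apply]
    simp only [Finsupp.smul_apply, am12_pow_bs_vacuum, smul_eq_mul, mul_ite, mul_zero,
      Finset.sum_ite_eq', Finset.mem_range]
    split_ifs with hl
    · rfl
    · rw [esymm_eq_zero_of_lt (by omega), zero_mul]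
  rw [List.prod_append, Module.End.mul_apply,
    prod_ofFn_apply (F := fun x => X1 q x) hap hX1 ws (bs_mem_middleSpan 0), map_sum,
    Finsupp.finsetSum_apply, Finset.mul_sum]
  symm
  refine Finset.sum_subset_zero_on_sdiff (Finset.range_mono (by omega)) (fun l hl => ?_)
    fun l hl => ?_
  · simp only [Finset.mem_sdiff, Finset.mem_range] at hl
    rw [ap12_pow_vacuum, map_smul, Finsupp.smul_apply, h3,
      esymm_eq_zero_of_lt (show a < l by omega), zero_mul, smul_zero]
  · have hla : l ≤ a := by
      have := Finset.mem_range.1 hl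
      omega
    rw [ap12_pow_vacuum, map_smul, Finsupp.smul_apply, h3, esymm_inv hla zs hz, smul_eq_mul]
    ring

end
end
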